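/- If G is a unicyclic graph on an even number n of vertices with maximum degree at most 3 such that any two vertices of degree 3 are adjacent, then T(G) = (n+2)/n. -/

import Mathlib

open SimpleGraph

/-- Number of connected components `ω(G)`. -/
noncomputable def SimpleGraph.omegaComp {W : Type*} (G : SimpleGraph W) : ℕ :=
  Nat.card G.ConnectedComponent

/-- Order `τ(G)` of a largest connected component of `G`. -/
noncomputable def SimpleGraph.tauMax {W : Type*} (G : SimpleGraph W) : ℕ :=
  sSup (Set.range fun c : G.ConnectedComponent =>
    Nat.card {v : W // G.connectedComponentMk v = c})

/-- The graph `G - X` obtained by deleting the vertices of `X`. -/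
def SimpleGraph.delVerts {V : Type*} (G : SimpleGraph V) (X : Finset V) :
    SimpleGraph {v : V // v ∉ X} :=
  SimpleGraph.comap Subtype.val G

/-- `X` is a vertex cut of `G`: deleting `X` leaves more than one component. -/
def SimpleGraph.IsVertexCut {V : Type*} (G : SimpleGraph V) (X : Finset V) : Prop :=
  1 < (G.delVerts X).omegaComp

/-- The tenacity `T(G) = min over vertex cuts X of (|X| + τ(G−X)) / ω(G−X)`. -/
noncomputable def SimpleGraph.tenacity {V : Type*} [Fintype V] (G : SimpleGraph V) : ℝ :=
  sInf { t : ℝ | ∃ X : Finset V, G.IsVertexCut X ∧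
    t = ((X.card : ℝ) + (G.delVerts X).tauMax) / (G.delVerts X).omegaComp }

/-- Vertex degree via `Nat.card` (no decidability assumptions needed). -/
noncomputable def SimpleGraph.deg {V : Type*} (G : SimpleGraph V) (v : V) : ℕ :=
  Nat.card (G.neighborSet v)

/-- A unicyclic graph: connected with as many edges as vertices. -/
def SimpleGraph.Unicyclic {V : Type*} [Fintype V] (G : SimpleGraph V) : Prop :=
  G.Connected ∧ Nat.card G.edgeSet = Fintype.card V

/-- The edges of `G` with an endpoint in `X`. -/
noncomputable def SimpleGraph.incidentEdges {V : Type*} [Fintype V] (G : SimpleGraph V)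
    (X : Finset V) : Finset (Sym2 V) := by
  classical exact {e ∈ G.edgeFinset | ∃ x ∈ X, x ∈ e}

namespace SimpleGraph

section Components

lemma omegaComp_bot {W : Type*} : (⊥ : SimpleGraph W).omegaComp = Nat.card W := by
  refine (Nat.card_congr (Equiv.ofBijective (⊥ : SimpleGraph W).connectedComponentMk
    ⟨fun u v h => ?_, fun c => c.exists_rep⟩)).symm
  simpa using ConnectedComponent.exact h

variable {W : Type*} [Finite W]

lemma omegaComp_le_of_le {H K : SimpleGraph W} (h : K ≤ H) : H.omegaComp ≤ K.omegaComp :=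
  ConnectedComponent.card_le_card_of_le h

lemma omegaComp_lt_deleteEdges_of_isBridge {H : SimpleGraph W} {u v : W}
    (h : H.IsBridge s(u, v)) (hadj : H.Adj u v) :
    H.omegaComp < (H.deleteEdges {s(u, v)}).omegaComp := by
  refine Nat.lt_of_le_of_ne (omegaComp_le_of_le (deleteEdges_le _)) fun heq => ?_
  have hsurj := ConnectedComponent.surjective_map_ofLE (H.deleteEdges_le {s(u, v)})
  have hinj := ((Nat.bijective_iff_surjective_and_card _).2 ⟨hsurj, heq.symm⟩).1
  refine (isBridge_iff.1 h) (ConnectedComponent.exact (hinj ?_))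
  exact ConnectedComponent.sound hadj.reachable

lemma IsAcyclic.omegaComp_add_card_edgeSet_le {H : SimpleGraph W} (hH : H.IsAcyclic) :
    H.omegaComp + Nat.card H.edgeSet ≤ Nat.card W := by
  induction hm : Nat.card H.edgeSet generalizing H with
  | zero =>
    have : H = ⊥ := by
      rw [← edgeSet_eq_empty]
      exact (Set.ncard_eq_zero (Set.toFinite _)).1 hm
    simp [this, omegaComp_bot]
  | succ m ih =>
    obtain ⟨e, he⟩ : H.edgeSet.Nonempty := by
      rw [← Set.ncard_pos (Set.toFinite _)]
      exact (Nat.succ_pos m).trans_eq hm.symm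
    induction e with | _ u v
    have hlt := omegaComp_lt_deleteEdges_of_isBridge (isAcyclic_iff_forall_isBridge.1 hH he) he
    have hcard : Nat.card (H.deleteEdges {s(u, v)}).edgeSet = m := by
      have := Set.ncard_sdiff_singleton_of_mem he
      rw [edgeSet_deleteEdges]
      change (H.edgeSet \ {s(u, v)}).ncard = m
      change H.edgeSet.ncard = m + 1 at hm
      omega
    have := ih (hH.anti (deleteEdges_le _)) hcard
    omega

lemma card_component_le_tauMax (H : SimpleGraph W) (c : H.ConnectedComponent) :
    Nat.card {v : W // H.connectedComponentMk v = c} ≤ H.tauMax :=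
  le_csSup (Set.finite_range _).bddAbove ⟨c, rfl⟩

lemma card_component_pos (H : SimpleGraph W) (c : H.ConnectedComponent) :
    0 < Nat.card {v : W // H.connectedComponentMk v = c} := by
  obtain ⟨v, hv⟩ := c.exists_rep
  have : Nonempty {v : W // H.connectedComponentMk v = c} := ⟨⟨v, hv⟩⟩
  exact Nat.card_pos

lemma exists_card_component_eq_tauMax (H : SimpleGraph W) [Nonempty W] :
    ∃ c : H.ConnectedComponent,
      Nat.card {v : W // H.connectedComponentMk v = c} = H.tauMax := by
  have : Nonempty H.ConnectedComponent := ⟨H.connectedComponentMk (Classical.arbitrary W)⟩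
  exact Nat.sSup_mem (Set.range_nonempty _) (Set.finite_range _).bddAbove

lemma tauMax_pos (H : SimpleGraph W) [Nonempty W] : 0 < H.tauMax := by
  obtain ⟨c, hc⟩ := H.exists_card_component_eq_tauMax
  exact hc ▸ H.card_component_pos c

lemma sum_card_component (H : SimpleGraph W) [Fintype H.ConnectedComponent] :
    ∑ c : H.ConnectedComponent, Nat.card {v : W // H.connectedComponentMk v = c} =
      Nat.card W := by
  rw [← Nat.card_sigma]
  exact Nat.card_congr (Equiv.sigmaFiberEquiv H.connectedComponentMk)

lemma omegaComp_le_card (H : SimpleGraph W) : H.omegaComp ≤ Nat.card W :=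
  Nat.card_le_card_of_surjective H.connectedComponentMk fun c => c.exists_rep

lemma card_le_omegaComp_mul_tauMax (H : SimpleGraph W) :
    Nat.card W ≤ H.omegaComp * H.tauMax := by
  classical
  have := Fintype.ofFinite H.ConnectedComponent
  rw [← H.sum_card_component, omegaComp, Nat.card_eq_fintype_card]
  simpa using Finset.sum_le_card_nsmul Finset.univ _ H.tauMax
    fun c _ => H.card_component_le_tauMax c

lemma omegaComp_add_tauMax_le (H : SimpleGraph W) [Nonempty W] :
    H.omegaComp + H.tauMax ≤ Nat.card W + 1 := by
  classical
  have := Fintype.ofFinite H.ConnectedComponent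
  obtain ⟨c, hc⟩ := H.exists_card_component_eq_tauMax
  have hsum := H.sum_card_component
  rw [← Finset.add_sum_erase _ _ (Finset.mem_univ c), hc] at hsum
  have hle := Finset.card_nsmul_le_sum (Finset.univ.erase c)
    (fun c => Nat.card {v : W // H.connectedComponentMk v = c}) 1
    fun c _ => H.card_component_pos c
  rw [Finset.card_erase_of_mem (Finset.mem_univ c), Finset.card_univ,
    ← Nat.card_eq_fintype_card, smul_eq_mul, mul_one] at hle
  change H.omegaComp - 1 ≤ _ at hle
  omega

lemma tauMax_bot [Nonempty W] : (⊥ : SimpleGraph W).tauMax = 1 := by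
  have h₁ := (⊥ : SimpleGraph W).omegaComp_add_tauMax_le
  have h₂ := (⊥ : SimpleGraph W).tauMax_pos
  rw [omegaComp_bot] at h₁
  omega

lemma isAcyclic_of_tauMax_le_two {H : SimpleGraph W} (h : H.tauMax ≤ 2) : H.IsAcyclic := by
  classical
  intro v c hc
  have hmem : ∀ w ∈ c.support.tail, H.connectedComponentMk w = H.connectedComponentMk v :=
    fun w hw => ConnectedComponent.sound
      (c.takeUntil w (List.mem_of_mem_tail hw)).reachable.symm
  have hsub : (c.support.tail.toFinset : Set W) ⊆
      {w | H.connectedComponentMk w = H.connectedComponentMk v} := by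
    intro w hw
    exact hmem w (by simpa using hw)
  have hcard := Set.ncard_le_ncard hsub (Set.toFinite _)
  rw [Set.ncard_coe_finset, List.toFinset_card_of_nodup hc.support_nodup, List.length_tail,
    Walk.length_support] at hcard
  have hle : ({w | H.connectedComponentMk w = H.connectedComponentMk v} : Set W).ncard ≤ _ :=
    H.card_component_le_tauMax (H.connectedComponentMk v)
  have := hc.three_le_length
  omega

end Components

section Deletion

variable {V : Type*} [Fintype V]

lemma mem_incidentEdges {G : SimpleGraph V} {X : Finset V} {e : Sym2 V} :
    e ∈ G.incidentEdges X ↔ e ∈ G.edgeSet ∧ ∃ x ∈ X, x ∈ e := by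
  classical simp [incidentEdges]

lemma card_notMem (X : Finset V) : Nat.card {v : V // v ∉ X} = Fintype.card V - X.card := by
  classical
  rw [Nat.card_eq_fintype_card, Fintype.card_subtype_compl]
  simp

lemma card_edgeSet_le_delVerts (K : SimpleGraph V) (X : Finset V) :
    Nat.card K.edgeSet ≤ Nat.card (K.delVerts X).edgeSet + (K.incidentEdges X).card := by
  have hsub : K.edgeSet ⊆ Sym2.map Subtype.val '' (K.delVerts X).edgeSet ∪
      (K.incidentEdges X : Set (Sym2 V)) := by
    intro e he
    by_cases hX : ∃ x ∈ X, x ∈ e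
    · exact Or.inr (mem_incidentEdges.2 ⟨he, hX⟩)
    · left
      induction e with | _ u v
      push Not at hX
      exact ⟨s(⟨u, fun h => hX u h (Sym2.mem_mk_left u v)⟩,
        ⟨v, fun h => hX v h (Sym2.mem_mk_right u v)⟩), he, rfl⟩
  calc K.edgeSet.ncard ≤ _ := Set.ncard_le_ncard hsub (Set.toFinite _)
    _ ≤ _ := Set.ncard_union_le _ _
    _ ≤ _ := by
      rw [Set.ncard_coe_finset]
      exact Nat.add_le_add_right (Set.ncard_image_le (Set.toFinite _)) _

lemma omegaComp_delVerts_add_le {G K : SimpleGraph V} (hK : K ≤ G) {X : Finset V}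
    (hacyc : (K.delVerts X).IsAcyclic) :
    (G.delVerts X).omegaComp + X.card + Nat.card K.edgeSet ≤
      Fintype.card V + (G.incidentEdges X).card := by
  have hle : K.delVerts X ≤ G.delVerts X := fun _ _ h => hK h
  have h₁ := omegaComp_le_of_le hle
  have h₂ := hacyc.omegaComp_add_card_edgeSet_le
  have h₃ := K.card_edgeSet_le_delVerts X
  have h₄ : (K.incidentEdges X).card ≤ (G.incidentEdges X).card :=
    Finset.card_le_card fun e he => by
      rw [mem_incidentEdges] at he ⊢
      exact ⟨edgeSet_mono hK he.1, he.2⟩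
  rw [card_notMem] at h₂
  have := X.card_le_univ
  omega

/-- If the maximum degree is at most `3` and the vertices of degree `3` are pairwise adjacent,
then at most `2 |X| + 1` edges meet `X`. -/
lemma card_incidentEdges_le {G : SimpleGraph V} (hdeg : ∀ v, G.deg v ≤ 3)
    (hadj : ∀ u v, G.deg u = 3 → G.deg v = 3 → u ≠ v → G.Adj u v) (X : Finset V) :
    (G.incidentEdges X).card ≤ 2 * X.card + 1 := by
  classical
  have hcard (v : V) : (G.incidenceFinset v).card = G.deg v := by
    rw [card_incidenceFinset_eq_degree, ← card_neighborSet_eq_degree, deg,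
      Nat.card_eq_fintype_card]
  have hmem (x : V) (e : Sym2 V) : e ∈ G.incidenceFinset x ↔ e ∈ G.edgeSet ∧ x ∈ e := by
    rw [mem_incidenceFinset]; rfl
  have hunion : G.incidentEdges X = X.biUnion fun x => G.incidenceFinset x := by
    ext e
    simp only [mem_incidentEdges, Finset.mem_biUnion, hmem]
    tauto
  by_cases h : ∃ x ∈ X, G.deg x = 3
  · obtain ⟨x₀, hx₀, h₀⟩ := h
    have hsub : G.incidentEdges X ⊆ G.incidenceFinset x₀ ∪
        (X.erase x₀).biUnion fun x => G.incidenceFinset x \ G.incidenceFinset x₀ := by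
      intro e he
      rw [hunion, Finset.mem_biUnion] at he
      obtain ⟨x, hx, hxe⟩ := he
      by_cases he₀ : e ∈ G.incidenceFinset x₀
      · exact Finset.mem_union_left _ he₀
      · refine Finset.mem_union_right _
          (Finset.mem_biUnion.2 ⟨x, ?_, Finset.mem_sdiff.2 ⟨hxe, he₀⟩⟩)
        exact Finset.mem_erase.2 ⟨fun h => he₀ (h ▸ hxe), hx⟩
    have hle : ∀ x ∈ X.erase x₀, (G.incidenceFinset x \ G.incidenceFinset x₀).card ≤ 2 := by
      intro x hx
      obtain ⟨hne, -⟩ := Finset.mem_erase.1 hx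
      by_cases h3 : G.deg x = 3
      · have hxx := hadj x x₀ h3 h₀ hne
        have hlt : (G.incidenceFinset x \ G.incidenceFinset x₀).card <
            (G.incidenceFinset x).card := by
          refine Finset.card_lt_card (Finset.ssubset_iff_of_subset Finset.sdiff_subset |>.2
            ⟨s(x, x₀), ?_, ?_⟩)
          · exact (hmem _ _).2 ⟨hxx, Sym2.mem_mk_left _ _⟩
          · rw [Finset.mem_sdiff, not_and_not_right]
            exact fun _ => (hmem _ _).2 ⟨hxx, Sym2.mem_mk_right _ _⟩
        rw [hcard] at hlt
        omega
      · have := Finset.card_le_card (Finset.sdiff_subset (s := G.incidenceFinset x)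
          (t := G.incidenceFinset x₀))
        have := hdeg x
        rw [hcard] at *
        omega
    have h₁ := Finset.card_le_card hsub
    have h₂ := Finset.card_union_le (G.incidenceFinset x₀)
      ((X.erase x₀).biUnion fun x => G.incidenceFinset x \ G.incidenceFinset x₀)
    have h₃ := Finset.card_biUnion_le_card_mul _ _ 2 hle
    rw [Finset.card_erase_of_mem hx₀] at h₃
    rw [hcard, h₀] at h₂
    have := Finset.card_pos.2 ⟨x₀, hx₀⟩
    omega
  · push Not at h
    rw [hunion]
    have := Finset.card_biUnion_le_card_mul X (fun x => G.incidenceFinset x) 2 fun x hx => by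
      have := hdeg x
      have := h x hx
      rw [hcard]
      omega
    omega

end Deletion

section Unicyclic

variable {V : Type*} [Fintype V] {G : SimpleGraph V}

lemma Unicyclic.exists_isTree_le (hG : G.Unicyclic) :
    ∃ T ≤ G, T.IsTree ∧ Nat.card T.edgeSet + 1 = Fintype.card V := by
  classical
  obtain ⟨T, hT, htree⟩ := hG.1.exists_isTree_le
  refine ⟨T, hT, htree, ?_⟩
  rw [← htree.card_edgeFinset, Nat.card_eq_fintype_card, edgeFinset_card]

lemma Unicyclic.three_le_card (hG : G.Unicyclic) : 3 ≤ Fintype.card V := by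
  classical
  have hle := G.card_edgeFinset_le_card_choose_two
  rw [edgeFinset_card, ← Nat.card_eq_fintype_card, hG.2] at hle
  have := hG.1.nonempty
  have hpos := Fintype.card_pos (α := V)
  by_contra! hlt
  interval_cases Fintype.card V <;> simp at hle

/-- A unicyclic graph of even order has an independent set on half of its vertices. -/
lemma Unicyclic.exists_half_indep (hG : G.Unicyclic) (heven : Even (Fintype.card V)) :
    ∃ I : Finset V, 2 * I.card = Fintype.card V ∧ ∀ u ∈ I, ∀ v ∈ I, ¬ G.Adj u v := by
  classical
  obtain ⟨T, hT, htree, hcard⟩ := hG.exists_isTree_le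
  obtain ⟨C⟩ := htree.colorable_two
  have hdiff : (G.edgeSet \ T.edgeSet).ncard = 1 := by
    have h := Set.ncard_sdiff_add_ncard_of_subset (edgeSet_mono hT) (Set.toFinite _)
    have h₁ : G.edgeSet.ncard = _ := hG.2
    change T.edgeSet.ncard + 1 = _ at hcard
    omega
  obtain ⟨e, he⟩ := Set.ncard_eq_one.1 hdiff
  induction e with | _ a b
  have hindep (I : Finset V) (ha : a ∉ I) (hI : ∀ u ∈ I, ∀ v ∈ I, C u = C v) :
      ∀ u ∈ I, ∀ v ∈ I, ¬ G.Adj u v := by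
    intro u hu v hv huv
    by_cases hTuv : T.Adj u v
    · exact C.valid hTuv (hI u hu v hv)
    · have hmem : s(u, v) ∈ G.edgeSet \ T.edgeSet := ⟨huv, hTuv⟩
      rw [he, Set.mem_singleton_iff, Sym2.eq_iff] at hmem
      rcases hmem with ⟨rfl, -⟩ | ⟨-, rfl⟩ <;> exact ha ‹_›
  obtain ⟨m, hm⟩ := heven
  have hsplit := Finset.card_filter_add_card_filter_not (s := (Finset.univ : Finset V)) (C · = C a)
  rw [Finset.card_univ] at hsplit
  obtain ⟨S, hSm, ha, hS⟩ : ∃ S : Finset V, m ≤ S.card ∧ a ∉ S ∧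
      ∀ u ∈ S, ∀ v ∈ S, C u = C v := by
    by_cases hB : m ≤ (Finset.univ.filter fun v => ¬ C v = C a).card
    · refine ⟨_, hB, by simp, fun u hu v hv => ?_⟩
      simp only [Finset.mem_filter, Finset.mem_univ, true_and] at hu hv
      omega
    · refine ⟨(Finset.univ.filter fun v => C v = C a).erase a, ?_, by simp, fun u hu v hv => ?_⟩
      · rw [Finset.card_erase_of_mem (by simp)]
        omega
      · simp only [Finset.mem_erase, Finset.mem_filter, Finset.mem_univ, true_and] at hu hv
        rw [hu.2, hv.2]
  obtain ⟨I, hIS, hI⟩ := Finset.exists_subset_card_eq hSm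
  exact ⟨I, by omega, hindep I (fun h => ha (hIS h))
    fun u hu v hv => hS u (hIS hu) v (hIS hv)⟩

lemma Unicyclic.exists_half_vertexCut (hG : G.Unicyclic) (heven : Even (Fintype.card V)) :
    ∃ X : Finset V, G.IsVertexCut X ∧ 2 * X.card = Fintype.card V ∧
      2 * (G.delVerts X).omegaComp = Fintype.card V ∧ (G.delVerts X).tauMax = 1 := by
  classical
  obtain ⟨I, hI, hindep⟩ := hG.exists_half_indep heven
  have h3 := hG.three_le_card
  have hbot : G.delVerts Iᶜ = ⊥ := by
    ext u v
    simpa [delVerts] using hindep u (by simpa using u.2) v (by simpa using v.2)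
  have hX := Finset.card_compl I
  have hcard : Nat.card {v : V // v ∉ Iᶜ} = I.card := by
    rw [card_notMem]
    omega
  have : Nonempty {v : V // v ∉ Iᶜ} := (Nat.card_pos_iff.1 (by omega)).1
  refine ⟨Iᶜ, ?_, by omega, ?_, ?_⟩
  · rw [IsVertexCut, hbot, omegaComp_bot]
    omega
  · rw [hbot, omegaComp_bot]
    omega
  · rw [hbot, tauMax_bot]

lemma Unicyclic.mul_omegaComp_le (hG : G.Unicyclic) (heven : Even (Fintype.card V))
    (hdeg : ∀ v, G.deg v ≤ 3)
    (hadj : ∀ u v, G.deg u = 3 → G.deg v = 3 → u ≠ v → G.Adj u v)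
    {X : Finset V} (hX : G.IsVertexCut X) :
    (Fintype.card V + 2) * (G.delVerts X).omegaComp ≤
      Fintype.card V * (X.card + (G.delVerts X).tauMax) := by
  have hinc := card_incidentEdges_le hdeg hadj X
  obtain ⟨T, hT, htree, hcard⟩ := hG.exists_isTree_le
  have hω := omegaComp_delVerts_add_le hT (X := X)
    (htree.isAcyclic.of_comap (Function.Embedding.subtype _))
  have hω' (h : (G.delVerts X).tauMax ≤ 2) :=
    omegaComp_delVerts_add_le (le_refl G) (isAcyclic_of_tauMax_le_two h)
  rw [hG.2] at hω'
  have hle := (G.delVerts X).omegaComp_le_card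
  have hmul := (G.delVerts X).card_le_omegaComp_mul_tauMax
  have hX' : 1 < (G.delVerts X).omegaComp := hX
  have : Nonempty {v : V // v ∉ X} := (Nat.card_pos_iff.1 (by omega)).1
  have hsum := (G.delVerts X).omegaComp_add_tauMax_le
  have hpos := (G.delVerts X).tauMax_pos
  rw [card_notMem] at hle hmul hsum
  have hXle := X.card_le_univ
  obtain ⟨m, hm⟩ := heven
  generalize (G.delVerts X).omegaComp = w at *
  generalize (G.delVerts X).tauMax = t at *
  generalize Fintype.card V = n at *
  generalize X.card = x at *
  have hwn : 2 * w ≤ n := by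
    rcases Nat.lt_or_ge 2 t with ht | ht
    · omega
    · have := hω' ht
      omega
  have hwt : w + 1 ≤ x + t := by
    rcases Nat.lt_or_ge 2 t with ht | ht
    · omega
    · have := hω' ht
      rcases Nat.lt_or_ge 1 t with ht' | ht'
      · omega
      · obtain rfl : t = 1 := by omega
        omega
  nlinarith [Nat.mul_le_mul_left n hwt]

end Unicyclic

end SimpleGraph

theorem unicyclic_even_good_degrees (n : ℕ) (heven : Even n)
    (G : SimpleGraph (Fin n)) (hG : G.Unicyclic)
    (hdeg : ∀ v, G.deg v ≤ 3)
    (hadj : ∀ u v, G.deg u = 3 → G.deg v = 3 → u ≠ v → G.Adj u v) :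
    G.tenacity = ((n : ℝ) + 2) / n := by
  have hcard : Fintype.card (Fin n) = n := Fintype.card_fin n
  have heven' : Even (Fintype.card (Fin n)) := hcard.symm ▸ heven
  have hn : (0 : ℝ) < n := by
    have := hG.three_le_card
    rw [hcard] at this
    exact_mod_cast (by omega : 0 < n)
  refine IsLeast.csInf_eq ⟨?_, ?_⟩
  · obtain ⟨X, hX, hXn, hω, hτ⟩ := hG.exists_half_vertexCut heven'
    refine ⟨X, hX, ?_⟩
    rw [hcard] at hXn hω
    have hXn' : 2 * (X.card : ℝ) = n := by exact_mod_cast hXn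
    have hω' : 2 * ((G.delVerts X).omegaComp : ℝ) = n := by exact_mod_cast hω
    rw [hτ, div_eq_div_iff hn.ne' (by linarith)]
    push_cast
    rw [← hXn'] at hω' ⊢
    have hωX : ((G.delVerts X).omegaComp : ℝ) = X.card := by linarith
    rw [hωX]
    ring
  · rintro _ ⟨X, hX, rfl⟩
    have hle := hG.mul_omegaComp_le heven' hdeg hadj hX
    have hω : (0 : ℝ) < (G.delVerts X).omegaComp := by
      exact_mod_cast Nat.zero_lt_of_lt hX
    rw [hcard] at hle
    rw [div_le_div_iff₀ hn hω, mul_comm _ (n : ℝ)]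
    exact_mod_cast hle
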